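/- arXiv:1911.09866 — 2 statements merged into one kernel-verified Lean document; each statement's English description precedes it below -/
import Mathlib

section
/- Let 1 ≤ b < n/2 − 1 and let T be an n-vertex chemical tree with exactly b branching vertices such that M2(T') ≤ M2(T) for every n-vertex chemical tree T' with exactly b branching vertices. Then T has at least one vertex of degree 4, and the subgraph of T induced by the vertices of degree 4 is a tree (in particular, it is connected). -/
open SimpleGraph

namespace ChemTree

variable {V : Type*}

/-- The degree of a vertex. -/
noncomputable def deg (G : SimpleGraph V) (v : V) : ℕ :=
  (G.neighborSet v).ncard

/-- A chemical tree: a tree in which every vertex has degree at most 4. -/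
def IsChemicalTree (G : SimpleGraph V) : Prop :=
  G.IsTree ∧ ∀ v, deg G v ≤ 4

/-- `nDeg G i` is the number of vertices of `G` having degree `i`. -/
noncomputable def nDeg (G : SimpleGraph V) (i : ℕ) : ℕ :=
  {v | deg G v = i}.ncard

/-- The first Zagreb index. -/
noncomputable def M1 (G : SimpleGraph V) [Fintype V] : ℕ :=
  ∑ v, (deg G v) ^ 2

/-- The second Zagreb index. -/
noncomputable def M2 (G : SimpleGraph V) [Fintype V] : ℕ :=
  ∑ e ∈ (Set.toFinite G.edgeSet).toFinset,
    Sym2.lift ⟨fun u w => deg G u * deg G w, fun u w => Nat.mul_comm _ _⟩ e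

/-- A segment: a nontrivial path whose end vertices have degree `≠ 2` and whose
internal vertices all have degree `2`. -/
def IsSegment (G : SimpleGraph V) {u v : V} (p : G.Walk u v) : Prop :=
  p.IsPath ∧ 0 < p.length ∧ deg G u ≠ 2 ∧ deg G v ≠ 2 ∧
    ∀ w ∈ p.support, w ≠ u → w ≠ v → deg G w = 2

/-- The number of segments: in a tree, a segment is uniquely determined by the
unordered pair of its end vertices. -/
noncomputable def numSegments (G : SimpleGraph V) : ℕ :=
  {s : Sym2 V | ∃ (u v : V) (p : G.Walk u v), s = s(u, v) ∧ IsSegment G p}.ncard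

/-- The number of branching vertices (vertices of degree at least 3). -/
noncomputable def numBranching (G : SimpleGraph V) : ℕ :=
  {v | 3 ≤ deg G v}.ncard

/-- An internal path: both end vertices are branching and all internal vertices
have degree `2`. -/
def IsInternalPath (G : SimpleGraph V) {u v : V} (p : G.Walk u v) : Prop :=
  p.IsPath ∧ 0 < p.length ∧ 3 ≤ deg G u ∧ 3 ≤ deg G v ∧
    ∀ w ∈ p.support, w ≠ u → w ≠ v → deg G w = 2

/-- A pendent path: one end vertex is pendent, the other is branching and all
internal vertices have degree `2`. -/
def IsPendentPath (G : SimpleGraph V) {u v : V} (p : G.Walk u v) : Prop :=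
  p.IsPath ∧ 0 < p.length ∧ deg G u = 1 ∧ 3 ≤ deg G v ∧
    ∀ w ∈ p.support, w ≠ u → w ≠ v → deg G w = 2

end ChemTree

open ChemTree

namespace ChemTree

variable {V : Type*}

/-- Replace the edge `xy` of `G` by the edge `xz`. -/
def slide (G : SimpleGraph V) (x y z : V) : SimpleGraph V :=
  G.deleteEdges {s(x, y)} ⊔ edge x z

section slide

variable {G : SimpleGraph V} {x y z : V}

lemma slide_adj {u v : V} : (slide G x y z).Adj u v ↔
    (G.Adj u v ∧ s(u, v) ≠ s(x, y)) ∨ (s(u, v) = s(x, z) ∧ u ≠ v) := by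
  simp [slide, edge_adj]

lemma not_reachable_slide_target (hG : G.IsAcyclic) (hxy : G.Adj x y)
    (hyz : (G.deleteEdges {s(x, y)}).Reachable y z) :
    ¬ (G.deleteEdges {s(x, y)}).Reachable x z := fun h ↦
  isBridge_iff.1 (isAcyclic_iff_forall_adj_isBridge.1 hG hxy) (h.trans hyz.symm)

lemma ne_slide_target (hG : G.IsAcyclic) (hxy : G.Adj x y)
    (hyz : (G.deleteEdges {s(x, y)}).Reachable y z) : x ≠ z := by
  rintro rfl
  exact not_reachable_slide_target hG hxy hyz .rfl

lemma not_adj_slide_target (hG : G.IsAcyclic) (hxy : G.Adj x y) (hne : y ≠ z)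
    (hyz : (G.deleteEdges {s(x, y)}).Reachable y z) : ¬ G.Adj x z := fun h ↦ by
  refine not_reachable_slide_target hG hxy hyz (Adj.reachable ?_)
  simp [deleteEdges_adj, h, hne.symm, hxy.ne]

lemma isTree_slide (hG : G.IsTree) (hxy : G.Adj x y)
    (hyz : (G.deleteEdges {s(x, y)}).Reachable y z) : (slide G x y z).IsTree := by
  by_cases hne : y = z
  · subst hne
    convert! hG
    ext u v
    rw [slide_adj]
    have := hxy.symm
    have := hxy.ne
    grind [Sym2.eq_iff]
  have hxz := ne_slide_target hG.isAcyclic hxy hyz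
  refine ⟨?_, (hG.isAcyclic.anti (deleteEdges_le _)).sup_edge_of_not_reachable
    (not_reachable_slide_target hG.isAcyclic hxy hyz)⟩
  have hdel : (G ⊔ edge x z).deleteEdges {s(x, y)} = slide G x y z := by
    ext u v
    simp only [deleteEdges_adj, sup_adj, edge_adj, slide_adj, Set.mem_singleton_iff, Sym2.eq_iff]
    grind
  rw [← hdel]
  refine (hG.connected.mono le_sup_left).connected_delete_edge_of_not_isBridge ?_
  rw [isBridge_iff, not_not, hdel]
  refine Reachable.trans (Adj.reachable (v := z) ?_) (hyz.symm.mono le_sup_left)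
  simp [slide_adj, hxz]

lemma deg_eq_of_neighborSet_eq {H : SimpleGraph V} {v : V}
    (h : H.neighborSet v = G.neighborSet v) : deg H v = deg G v := by
  rw [deg, deg, h]

lemma deg_slide_of_ne {v : V} (hx : v ≠ x) (hy : v ≠ y) (hz : v ≠ z) :
    deg (slide G x y z) v = deg G v := by
  refine deg_eq_of_neighborSet_eq ?_
  ext w
  simp only [mem_neighborSet, slide_adj, Sym2.eq_iff]
  grind

variable [Finite V]

lemma deg_slide_source (hxy : G.Adj x y) (hyz : y ≠ z) :
    deg (slide G x y z) y + 1 = deg G y := by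
  have h : (slide G x y z).neighborSet y = G.neighborSet y \ {x} := by
    ext v
    have := hxy.ne
    simp only [mem_neighborSet, slide_adj, Set.mem_sdiff, Set.mem_singleton_iff, Sym2.eq_iff]
    grind
  rw [deg, h]
  exact Set.ncard_sdiff_singleton_add_one hxy.symm (Set.toFinite _)

lemma deg_slide_target (hxz : ¬ G.Adj x z) (hne : x ≠ z) (hyz : y ≠ z) :
    deg (slide G x y z) z = deg G z + 1 := by
  have h : (slide G x y z).neighborSet z = insert x (G.neighborSet z) := by
    ext v
    simp only [mem_neighborSet, slide_adj, Set.mem_insert_iff, Sym2.eq_iff]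
    grind
  rw [deg, h]
  exact Set.ncard_insert_of_notMem (fun h : G.Adj z x ↦ hxz h.symm) (Set.toFinite _)

lemma deg_slide_pivot (hxy : G.Adj x y) (hxz : ¬ G.Adj x z) (hne : x ≠ z) :
    deg (slide G x y z) x = deg G x := by
  have h : (slide G x y z).neighborSet x = insert z (G.neighborSet x \ {y}) := by
    ext v
    have := hxy.ne
    simp only [mem_neighborSet, slide_adj, Set.mem_insert_iff, Sym2.eq_iff, Set.mem_sdiff,
      Set.mem_singleton_iff]
    grind
  rw [deg, h, Set.ncard_insert_of_notMem (fun h ↦ hxz h.1) (Set.toFinite _)]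
  exact Set.ncard_sdiff_singleton_add_one hxy (Set.toFinite _)

end slide

section edgeSum

/-- The product of the values of `g` at the two ends of an edge. -/
def edgeWeight (g : V → ℕ) : Sym2 V → ℕ :=
  Sym2.lift ⟨fun u w ↦ g u * g w, fun _ _ ↦ Nat.mul_comm _ _⟩

@[simp]
lemma edgeWeight_mk (g : V → ℕ) (u v : V) : edgeWeight g s(u, v) = g u * g v := rfl

variable [Fintype V]

/-- The sum over all edges of the product of the values of `g` at the two ends. -/
noncomputable def edgeSum (G : SimpleGraph V) (g : V → ℕ) : ℕ :=
  ∑ e ∈ (Set.toFinite G.edgeSet).toFinset, edgeWeight g e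

lemma M2_eq_edgeSum (G : SimpleGraph V) : M2 G = edgeSum G (deg G) := rfl

lemma edgeSum_slide {G : SimpleGraph V} {x y z : V} (hxy : G.Adj x y) (hxz : ¬ G.Adj x z)
    (hne : x ≠ z) (g : V → ℕ) :
    edgeSum (slide G x y z) g + g x * g y = edgeSum G g + g x * g z := by
  classical
  have h : (Set.toFinite (slide G x y z).edgeSet).toFinset =
      insert s(x, z) ((Set.toFinite G.edgeSet).toFinset.erase s(x, y)) := by
    ext e
    induction e with | h u v => ?_
    simp only [Set.Finite.mem_toFinset, mem_edgeSet, slide_adj, Finset.mem_insert,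
      Finset.mem_erase, Sym2.eq_iff]
    grind
  rw [edgeSum, h, Finset.sum_insert (by simp [hxz]), edgeSum,
    ← Finset.sum_erase_add _ _ (show s(x, y) ∈ (Set.toFinite G.edgeSet).toFinset by simpa)]
  simp only [edgeWeight_mk]
  ring

end edgeSum

section tree

variable {T : SimpleGraph V}

lemma deg_eq_four_of_mem_support
    (h : ∀ {a b : V} (hab : T.Adj a b), deg T a = 4 → deg T b ≠ 4 → ∀ {c : V} (p : T.Walk b c),
      (Walk.cons hab p).IsPath → deg T c ≠ 4) {u v : V} (p : T.Walk u v) (hp : p.IsPath)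
    (hu : deg T u = 4) (hv : deg T v = 4) : ∀ w ∈ p.support, deg T w = 4 := by
  induction p with
  | nil => simpa
  | @cons _ w _ huw p ih =>
    by_cases hw : deg T w = 4
    · simpa [hu] using ih hp.of_cons hw hv
    · exact absurd hv (h huw hu hw p hp)

lemma exists_adj_notMem_support (hT : T.IsAcyclic) {a c : V} {q : T.Walk a c} (hq : q.IsPath)
    (hc : 2 ≤ deg T c) : ∃ d, T.Adj c d ∧ d ∉ q.support := by
  obtain ⟨d, hd, hne⟩ := Set.exists_ne_of_one_lt_ncard (s := T.neighborSet c) hc q.penultimate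
  exact ⟨d, hd, fun h ↦ hne (hT.eq_penultimate_of_adj_end hq hd h)⟩

variable [Fintype V]

/-- Reversing the middle segment of a path `a b ⋯ c d` keeps a tree a tree with the same degrees. -/
lemma exists_isTree_swap (hT : T.IsTree) {a b c d : V} (hab : T.Adj a b) (p : T.Walk b c)
    (hp : (Walk.cons hab p).IsPath) (hcd : T.Adj c d) (hd : d ∉ (Walk.cons hab p).support)
    (hbc : b ≠ c) :
    ∃ T' : SimpleGraph V, T'.IsTree ∧ (∀ v, deg T' v = deg T v) ∧
      ∀ g : V → ℕ, edgeSum T' g + g a * g b + g c * g d = edgeSum T g + g a * g c + g b * g d := by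
  rw [Walk.cons_isPath_iff] at hp
  obtain ⟨hp, ha⟩ := hp
  simp only [Walk.support_cons, List.mem_cons, not_or] at hd
  obtain ⟨hda, hd⟩ := hd
  have hac : a ≠ c := by rintro rfl; simp at ha
  have hdb : d ≠ b := by rintro rfl; simp at hd
  have hr : (T.deleteEdges {s(a, b)}).Reachable b c :=
    reachable_deleteEdges_iff_exists_walk.2 ⟨p, fun h ↦ ha (p.fst_mem_support_of_mem_edges h)⟩
  have hnac := not_adj_slide_target hT.isAcyclic hab hbc hr
  have hT₁ := isTree_slide hT hab hr
  have hdc : (slide T a b c).Adj d c := by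
    rw [slide_adj]
    simp [hcd.symm, hda, hdb]
  have hr₁ : ((slide T a b c).deleteEdges {s(d, c)}).Reachable c b := by
    refine ⟨(p.transfer _ fun e he ↦ ?_).reverse⟩
    have hae : a ∉ e := fun h ↦ ha (p.mem_support_of_mem_edges he h)
    have hde : d ∉ e := fun h ↦ hd (p.mem_support_of_mem_edges he h)
    have heT := p.edges_subset_edgeSet he
    induction e with | h u v => ?_
    simp only [mem_edgeSet, Sym2.mem_iff] at *
    rw [deleteEdges_adj, slide_adj]
    simp only [Set.mem_singleton_iff, ne_eq, Sym2.eq_iff]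
    grind
  have hndb := not_adj_slide_target hT₁.isAcyclic hdc hbc.symm hr₁
  refine ⟨slide (slide T a b c) d c b, isTree_slide hT₁ hdc hr₁, fun v ↦ ?_, fun g ↦ ?_⟩
  · have h1 := deg_slide_source (z := c) hab hbc
    have h2 := deg_slide_target (y := b) hnac hac hbc
    have h3 := deg_slide_pivot hab hnac hac
    have h4 := deg_slide_source (z := b) hdc hbc.symm
    have h5 := deg_slide_target (y := c) hndb hdb hbc.symm
    have h6 := deg_slide_pivot hdc hndb hdb
    have h7 := deg_slide_of_ne (G := T) (x := a) (y := b) (z := c) (v := v)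
    have h8 := deg_slide_of_ne (G := slide T a b c) (x := d) (y := c) (z := b) (v := v)
    by_cases va : v = a <;> by_cases vb : v = b <;> by_cases vc : v = c <;> by_cases vd : v = d <;>
      grind
  · have h1 := edgeSum_slide hab hnac hac g
    have h2 := edgeSum_slide hdc hndb hdb g
    have h3 := Nat.mul_comm (g c) (g d)
    have h4 := Nat.mul_comm (g b) (g d)
    omega

lemma not_exists_path_through_deg_ne_four {b' : ℕ} (hT : IsChemicalTree T)
    (hbr : numBranching T = b')
    (hmax : ∀ T' : SimpleGraph V, IsChemicalTree T' → numBranching T' = b' → M2 T' ≤ M2 T)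
    {a b : V} (hab : T.Adj a b) (ha : deg T a = 4) (hb : deg T b ≠ 4) {c : V} (p : T.Walk b c)
    (hp : (Walk.cons hab p).IsPath) : deg T c ≠ 4 := by
  intro hc
  obtain ⟨d, hcd, hd⟩ := exists_adj_notMem_support hT.1.isAcyclic hp (by omega)
  by_cases hd4 : deg T d = 4
  · have hp' : (Walk.cons hab (p.concat hcd)).IsPath := by
      simpa [Walk.concat_cons] using hp.concat hd hcd
    have hlt := hp'.length_lt
    exact not_exists_path_through_deg_ne_four hT hbr hmax hab ha hb (p.concat hcd) hp' hd4
  · obtain ⟨T', hT', hdeg, hsum⟩ := exists_isTree_swap hT.1 hab p hp hcd hd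
      (by rintro rfl; exact hb hc)
    have hdeg' : deg T' = deg T := funext hdeg
    have hle := hmax T' ⟨hT', by simpa [hdeg'] using hT.2⟩
      (by rw [← hbr]; simp [numBranching, hdeg'])
    have hs := hsum (deg T)
    rw [M2_eq_edgeSum, M2_eq_edgeSum, hdeg'] at hle
    rw [ha, hc] at hs
    have h1 := hT.2 b
    have h2 := hT.2 d
    have h3 : deg T b < 4 := by omega
    have h4 : deg T d < 4 := by omega
    nlinarith
termination_by Fintype.card V - p.length
decreasing_by
  simp only [Walk.length_cons, Walk.length_concat] at hlt ⊢
  omega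

lemma exists_deg_eq_two (hT : T.IsTree) (hle : ∀ v, deg T v ≤ 3)
    (hb1 : 1 ≤ numBranching T) (hlt : 2 * numBranching T + 2 < Fintype.card V) :
    ∃ v, deg T v = 2 := by
  classical
  by_contra! hne
  have hdeg : ∀ v, deg T v = T.degree v := fun v ↦ by
    rw [deg, Set.ncard_eq_toFinset_card', ← card_neighborFinset_eq_degree]; rfl
  have hsum := T.sum_degrees_eq_twice_card_edges
  have hedge := hT.card_edgeFinset
  have : Nontrivial V := Fintype.one_lt_card_iff_nontrivial.1 (by omega)
  have hval : ∀ v, T.degree v = 1 + if 3 ≤ deg T v then 2 else 0 := fun v ↦ by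
    have h1 := hT.connected.preconnected.degree_pos_of_nontrivial v
    have h2 := hle v
    have h3 := hne v
    rw [hdeg] at *
    split_ifs <;> omega
  have hnb : numBranching T = (Finset.univ.filter fun v ↦ 3 ≤ deg T v).card := by
    rw [numBranching, Set.ncard_eq_toFinset_card']
    simp
  simp_rw [hval] at hsum
  rw [Finset.sum_add_distrib, ← Finset.sum_filter] at hsum
  simp at hsum
  omega

lemma exists_adj_deg_two_deg_three (hT : T.IsTree) (hle : ∀ v, deg T v ≤ 3)
    {w u : V} (hw : deg T w = 2) (hu : deg T u = 3) :
    ∃ w u, T.Adj w u ∧ deg T w = 2 ∧ deg T u = 3 := by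
  obtain ⟨p⟩ := hT.connected.preconnected w u
  obtain ⟨⟨⟨s, t⟩, hst⟩, -, hs, ht⟩ := p.exists_boundary_dart
    {v | deg T v = 2 ∨ deg T v = 1 ∧ ∃ x, T.Adj v x ∧ deg T x = 2} (by simp [hw]) (by simp [hu])
  simp only [Set.mem_ofPred_eq, not_or, not_and, not_exists] at hst hs ht
  have hpos : deg T t ≠ 0 := fun h ↦ by
    rw [deg, Set.ncard_eq_zero] at h
    exact (h ▸ (show s ∈ T.neighborSet t from hst.symm) : s ∈ (∅ : Set V))
  have h3 := hle t
  obtain hs | ⟨hs, x, hsx, hx⟩ := hs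
  · refine ⟨s, t, hst, hs, ?_⟩
    have h1 : deg T t ≠ 1 := fun h ↦ ht.2 h s hst.symm hs
    have h2 : deg T t ≠ 2 := ht.1
    omega
  · obtain ⟨y, hy⟩ := Set.ncard_eq_one.1 hs
    have h1 : x ∈ T.neighborSet s := hsx
    have h2 : t ∈ T.neighborSet s := hst
    rw [hy, Set.mem_singleton_iff] at h1 h2
    exact absurd (h1 ▸ hx) (h2 ▸ ht.1)

/-- Moving the far neighbor `x` of a vertex `w` of degree 2 to a neighbor `u` of `w` of degree 3. -/
lemma exists_isChemicalTree_M2_lt (hT : IsChemicalTree T) {w u : V} (hwu : T.Adj w u)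
    (hw : deg T w = 2) (hu : deg T u = 3) :
    ∃ T' : SimpleGraph V, IsChemicalTree T' ∧ numBranching T' = numBranching T ∧
      M2 T < M2 T' := by
  classical
  obtain ⟨x, hwx, hxu⟩ := Set.exists_ne_of_one_lt_ncard (s := T.neighborSet w)
    (by change 1 < deg T w; omega) u
  obtain ⟨z, huz, hzw⟩ := Set.exists_ne_of_one_lt_ncard (s := T.neighborSet u)
    (by change 1 < deg T u; omega) w
  simp only [mem_neighborSet] at hwx huz
  have hne := hwu.ne
  have hxw : T.Adj x w := hwx.symm
  have hr : (T.deleteEdges {s(x, w)}).Reachable w u := by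
    refine Adj.reachable ?_
    simp [deleteEdges_adj, hwu, hxw.ne', hxu.symm]
  have hnxu := not_adj_slide_target hT.1.isAcyclic hxw hne hr
  have hzx : z ≠ x := by rintro rfl; exact hnxu huz.symm
  have hdw := deg_slide_source (z := u) hxw hne
  have hdu := deg_slide_target (y := w) hnxu hxu hne
  have hdx := deg_slide_pivot hxw hnxu hxu
  have hdv := fun v ↦ deg_slide_of_ne (G := T) (x := x) (y := w) (z := u) (v := v)
  have hT' := isTree_slide hT.1 hxw hr
  have hsum := edgeSum_slide hxw hnxu hxu (deg (slide T x w u))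
  set T' := slide T x w u
  have hge : ∀ v, v ≠ w → deg T v ≤ deg T' v := fun v hvw ↦ by
    by_cases hvx : v = x <;> by_cases hvu : v = u <;> grind
  refine ⟨T', ⟨hT', fun v ↦ ?_⟩, ?_, ?_⟩
  · have := hT.2 v
    by_cases hvx : v = x <;> by_cases hvu : v = u <;> by_cases hvw : v = w <;> grind
  · have h : {v | 3 ≤ deg T' v} = {v | 3 ≤ deg T v} := by
      ext v
      simp only [Set.mem_ofPred_eq]
      by_cases hvx : v = x <;> by_cases hvu : v = u <;> by_cases hvw : v = w <;> grind
    rw [numBranching, h, numBranching]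
  · rw [M2_eq_edgeSum, M2_eq_edgeSum]
    set E := (Set.toFinite T.edgeSet).toFinset with hE
    have hE1 : s(w, u) ∈ E := by simpa [hE]
    have hE2 : s(w, x) ∈ E.erase s(w, u) := by simp [hE, hwx, hxu, hne]
    have hE3 : s(u, z) ∈ (E.erase s(w, u)).erase s(w, x) := by
      simp [hE, huz, hne.symm, hzw, hxu.symm]
    have hsplit : ∀ g : V → ℕ, edgeSum T g = ∑ e ∈ ((E.erase s(w, u)).erase s(w, x)).erase s(u, z),
        edgeWeight g e + g u * g z + g w * g x + g w * g u := fun g ↦ by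
      rw [edgeSum, ← Finset.sum_erase_add _ _ hE1, ← Finset.sum_erase_add _ _ hE2,
        ← Finset.sum_erase_add _ _ hE3]
      rfl
    have hrest : ∑ e ∈ ((E.erase s(w, u)).erase s(w, x)).erase s(u, z), edgeWeight (deg T) e ≤
        ∑ e ∈ ((E.erase s(w, u)).erase s(w, x)).erase s(u, z), edgeWeight (deg T') e := by
      refine Finset.sum_le_sum fun e he ↦ ?_
      have hwe : w ∉ e := by
        intro hmem
        obtain ⟨y, rfl⟩ := Sym2.mem_iff_exists.1 hmem
        simp only [hE, Finset.mem_erase, Set.Finite.mem_toFinset, mem_edgeSet] at he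
        have hsub : ({u, x, y} : Set V) ⊆ T.neighborSet w := by
          rintro v (rfl | rfl | rfl)
          exacts [hwu, hwx, he.2.2.2]
        have hle := Set.ncard_le_ncard hsub (Set.toFinite _)
        have hyu : u ≠ y := by rintro rfl; exact he.2.2.1 rfl
        have hyx : x ≠ y := by rintro rfl; exact he.2.1 rfl
        rw [Set.ncard_eq_three.2 ⟨u, x, y, hxu.symm, hyu, hyx, rfl⟩] at hle
        change 3 ≤ deg T w at hle
        omega
      induction e with | h s t => ?_
      simp only [Sym2.mem_iff, not_or] at hwe
      exact Nat.mul_le_mul (hge s (Ne.symm hwe.1)) (hge t (Ne.symm hwe.2))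
    have hxpos : 0 < deg T x := (Set.ncard_pos (Set.toFinite _)).2 ⟨w, hxw⟩
    have hzpos : 0 < deg T z := (Set.ncard_pos (Set.toFinite _)).2 ⟨u, huz.symm⟩
    have hdz := hdv z hzx hzw huz.ne'
    have hdw' : deg T' w = 1 := by omega
    rw [hsplit (deg T)]
    rw [hsplit (deg T'), hdw', hdu, hdx, hdz, hu] at hsum
    rw [hw, hu]
    omega

end tree

end ChemTree

theorem stmt_18 {V : Type*} [Fintype V] (n b : ℕ)
    (hcard : Fintype.card V = n) (hb1 : 1 ≤ b) (hb2 : (b : ℚ) < (n : ℚ) / 2 - 1)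
    (T : SimpleGraph V) (hT : IsChemicalTree T) (hbr : numBranching T = b)
    (hmax : ∀ T' : SimpleGraph V, IsChemicalTree T' → numBranching T' = b →
      M2 T' ≤ M2 T) :
    (∃ v : V, deg T v = 4) ∧ (T.induce {v | deg T v = 4}).IsTree := by
  have hlt : 2 * b + 2 < n := by
    have h : (2 * b + 2 : ℚ) < n := by linarith
    exact_mod_cast h
  have hex : ∃ v : V, deg T v = 4 := by
    by_contra! hne
    have hle : ∀ v, deg T v ≤ 3 := fun v ↦ by
      have h1 := hT.2 v
      have h2 := hne v
      omega
    obtain ⟨w, hw⟩ := exists_deg_eq_two hT.1 hle (hbr ▸ hb1) (by rw [hbr, hcard]; exact hlt)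
    obtain ⟨u, hu⟩ := (Set.ncard_pos (Set.toFinite _)).1 (show 0 < numBranching T by omega)
    obtain ⟨w, u, hwu, hw, hu⟩ := exists_adj_deg_two_deg_three hT.1 hle hw
      (le_antisymm (hle u) hu)
    obtain ⟨T', hT', hbr', hM⟩ := exists_isChemicalTree_M2_lt hT hwu hw hu
    exact (hmax T' hT' (hbr'.trans hbr)).not_gt hM
  refine ⟨hex, ?_, hT.1.isAcyclic.induce _⟩
  have : Nonempty {v | deg T v = 4} := hex.elim fun v hv ↦ ⟨v, hv⟩
  refine ⟨?_⟩
  rintro ⟨u, hu⟩ ⟨v, hv⟩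
  obtain ⟨p, hp⟩ := hT.1.connected.exists_isPath u v
  exact ⟨p.induce _ (deg_eq_four_of_mem_support
    (not_exists_path_through_deg_ne_four hT hbr hmax) p hp hu hv)⟩
end

section
/- Let n ≥ 4 and let T be an n-vertex chemical tree with exactly n/2 − 1 branching vertices (so n is even). Then every vertex of T has degree 1 or 3, M1(T) = 5n−8, and M2(T) = 6n−15. -/
open SimpleGraph

namespace ChemTree

theorem deg_eq_degree {V : Type*} (G : SimpleGraph V) (v : V) [Fintype (G.neighborSet v)] :
    deg G v = G.degree v := by
  rw [deg, Set.ncard_eq_toFinset_card', ← SimpleGraph.card_neighborFinset_eq_degree,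
    SimpleGraph.neighborFinset]

/-- Summing `f u + f w` over the edges `uw` counts each `f v` once per edge at `v`. -/
theorem sum_edgeFinset_sum_mem {V : Type*} [Fintype V] [DecidableEq V] (G : SimpleGraph V)
    [DecidableRel G.Adj] (f : V → ℕ) :
    ∑ e ∈ G.edgeFinset, ∑ v with v ∈ e, f v = ∑ v, G.degree v * f v := by
  simp_rw [Finset.sum_filter]
  rw [Finset.sum_comm]
  refine Finset.sum_congr rfl fun v _ => ?_
  rw [← Finset.sum_filter, Finset.sum_const, smul_eq_mul,
    ← G.incidenceFinset_eq_filter, G.card_incidenceFinset_eq_degree]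

/-- In a connected graph, an edge between two vertices of degree one is the whole graph. -/
theorem card_le_two_of_adj_of_degree_eq_one {V : Type*} [Fintype V] {G : SimpleGraph V}
    [DecidableRel G.Adj] (hG : G.Preconnected) {u w : V} (huw : G.Adj u w)
    (hu : G.degree u = 1) (hw : G.degree w = 1) : Fintype.card V ≤ 2 := by
  classical
  obtain ⟨a, ha⟩ := Finset.card_eq_one.mp ((G.card_neighborFinset_eq_degree u).trans hu)
  obtain ⟨b, hb⟩ := Finset.card_eq_one.mp ((G.card_neighborFinset_eq_degree w).trans hw)
  have hua (x : V) : G.Adj u x ↔ x = a := by simpa using Finset.ext_iff.mp ha x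
  have hwb (x : V) : G.Adj w x ↔ x = b := by simpa using Finset.ext_iff.mp hb x
  have key : ∀ {x y : V}, G.Walk x y → (x = u ∨ x = w) → (y = u ∨ y = w) := by
    intro x y p
    induction p with
    | nil => exact id
    | @cons x z y h p ih =>
      rintro (rfl | rfl)
      · exact ih (Or.inr (((hua z).mp h).trans ((hua w).mp huw).symm))
      · exact ih (Or.inl (((hwb z).mp h).trans ((hwb u).mp huw.symm).symm))
  have huniv : (Finset.univ : Finset V) ⊆ {u, w} := fun y _ => by
    simpa using key (hG u y).some (Or.inl rfl)
  exact (Finset.card_le_card huniv).trans Finset.card_le_two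

end ChemTree

open ChemTree

theorem stmt_19 {V : Type*} [Fintype V] (n : ℕ)
    (hcard : Fintype.card V = n) (hn : 4 ≤ n)
    (T : SimpleGraph V) (hT : IsChemicalTree T)
    (hbr : (numBranching T : ℚ) = (n : ℚ) / 2 - 1) :
    Even n ∧ (∀ v : V, deg T v = 1 ∨ deg T v = 3) ∧
      (M1 T : ℚ) = 5 * n - 8 ∧ (M2 T : ℚ) = 6 * n - 15 := by
  classical
  obtain ⟨hTree, -⟩ := hT
  have hconn : T.Preconnected := hTree.connected.preconnected
  have hb : 2 * numBranching T + 2 = n := by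
    have : (2 * numBranching T + 2 : ℚ) = n := by rw [hbr]; ring
    exact_mod_cast this
  have hedges : T.edgeFinset.card + 1 = n := hTree.card_edgeFinset.trans hcard
  have hsum : ∑ v, T.degree v = 2 * T.edgeFinset.card := T.sum_degrees_eq_twice_card_edges
  have : Nontrivial V := Fintype.one_lt_card_iff_nontrivial.mp (by omega)
  have hpos (v : V) : 0 < T.degree v := hconn.degree_pos_of_nontrivial v
  have hnb : numBranching T = ({v | 3 ≤ T.degree v} : Finset V).card := by
    rw [numBranching, Set.ncard_eq_toFinset_card']
    congr 1
    ext v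
    simp [deg_eq_degree]
  have hle (v : V) : (if 3 ≤ T.degree v then 2 else 0) + 1 ≤ T.degree v := by
    have := hpos v
    split_ifs <;> omega
  have hdeg (v : V) : T.degree v = 1 ∨ T.degree v = 3 := by
    have heq : ∑ v, ((if 3 ≤ T.degree v then 2 else 0) + 1) = ∑ v, T.degree v := by
      rw [Finset.sum_add_distrib, ← Finset.sum_filter, Finset.sum_const, Finset.sum_const,
        ← hnb, Finset.card_univ, hcard, hsum, smul_eq_mul, smul_eq_mul]
      omega
    have := (Finset.sum_eq_sum_iff_of_le fun v _ => hle v).mp heq v (Finset.mem_univ v)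
    split_ifs at this <;> omega
  have hM1 : M1 T + 3 * n = 4 * (2 * T.edgeFinset.card) := by
    rw [M1, ← hsum, Finset.mul_sum, ← hcard, ← Finset.card_univ, mul_comm 3, ← smul_eq_mul,
      ← Finset.sum_const, ← Finset.sum_add_distrib]
    refine Finset.sum_congr rfl fun v _ => ?_
    rw [deg_eq_degree]
    rcases hdeg v with h | h <;> rw [h] <;> norm_num
  have hM2 : M2 T + 9 * T.edgeFinset.card = 3 * M1 T := by
    have hM1' : M1 T = ∑ e ∈ T.edgeFinset, ∑ v with v ∈ e, T.degree v := by
      rw [sum_edgeFinset_sum_mem, M1]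
      exact Finset.sum_congr rfl fun v _ => by rw [deg_eq_degree, sq]
    have hset : (Set.toFinite T.edgeSet).toFinset = T.edgeFinset := by ext; simp
    rw [hM1', M2, hset, Finset.mul_sum, mul_comm 9, ← smul_eq_mul, ← Finset.sum_const,
      ← Finset.sum_add_distrib]
    refine Finset.sum_congr rfl fun e he => ?_
    induction e using Sym2.ind with
    | _ u w =>
      have huw : T.Adj u w := by simpa using he
      have hfilter : ({v | v ∈ s(u, w)} : Finset V) = {u, w} := by ext; simp
      rw [hfilter, Finset.sum_pair huw.ne, Sym2.lift_mk]
      change deg T u * deg T w + 9 = _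
      rw [deg_eq_degree, deg_eq_degree]
      rcases hdeg u with hu | hu <;> rcases hdeg w with hw | hw
      · have := card_le_two_of_adj_of_degree_eq_one hconn huw hu hw
        omega
      all_goals norm_num [hu, hw]
  refine ⟨⟨numBranching T + 1, by omega⟩, fun v => deg_eq_degree T v ▸ hdeg v, ?_, ?_⟩
  · have : M1 T + 8 = 5 * n := by omega
    rw [eq_sub_iff_add_eq]
    exact_mod_cast this
  · have : M2 T + 15 = 6 * n := by omega
    rw [eq_sub_iff_add_eq]
    exact_mod_cast this
end
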